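/- Assume 0 < m < 1, 0 < β < (m+1)^2/2, γ > 0, d_{11} ≥ 0, d_{22} ≥ 0, d_{21} ≥ 0 and ℓ > 0, and set v_* = 1 - β/(m+1). Then β < m+1 (so v_* > 0), and for every n ∈ ℕ₀, T_n = (a_{11}+a_{22}) - (d_{11}+d_{22}) n^2/ℓ^2 < 0 and J̃_n(0) = d_{11} d_{22} n^4/ℓ^4 - (d_{11} a_{22} + d_{22} a_{11} + d_{21} a_{12} v_*) n^2/ℓ^2 + a_{11} a_{22} - a_{12} b_{21} > 0; consequently every complex root λ of λ^2 - T_n λ + J̃_n(0) = 0 satisfies Re λ < 0 (the positive steady state is asymptotically stable at zero delay). -/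

import Mathlib

theorem root_re_neg (T J : ℝ) (hT : T < 0) (hJ : 0 < J) (z : ℂ)
    (h : z ^ 2 - (T : ℂ) * z + (J : ℂ) = 0) : z.re < 0 := by
  by_contra! hx
  have h1 := congrArg Complex.re h
  have h2 := congrArg Complex.im h
  simp [pow_two] at h1 h2
  have h3 : z.im * (2 * z.re - T) = 0 := by linarith
  have h4 : z.im = 0 := by
    rcases mul_eq_zero.mp h3 with h | h
    · exact h
    · linarith
  rw [h4] at h1
  nlinarith [mul_nonneg hx hx, mul_nonneg hx (neg_pos.mpr hT).le]

/-- For the model with memory and gestation delays under condition (C₀)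
(0 < m < 1, 0 < β < (m+1)²/2), γ > 0, d₁₁, d₂₂, d₂₁ ≥ 0, ℓ > 0: β < m+1 (so v_* > 0),
and for every n ∈ ℕ₀, T_n < 0 and J̃_n(0) > 0; consequently every complex root of
λ² - T_n λ + J̃_n(0) = 0 has negative real part. -/
theorem stmt17 (m β γ d11 d22 d21 ℓ : ℝ)
    (hm0 : 0 < m) (hm1 : m < 1) (hβ0 : 0 < β) (hβ : β < (m + 1) ^ 2 / 2)
    (hγ : 0 < γ) (hd11 : 0 ≤ d11) (hd22 : 0 ≤ d22) (hd21 : 0 ≤ d21) (hℓ : 0 < ℓ) :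
    let a11 := 2 * β / (m + 1) ^ 2 - 1
    let a12 := β * (m - 1) / (m + 1) ^ 2
    let a22 := -γ
    let b21 := γ
    let v := 1 - β / (m + 1)
    β < m + 1 ∧
    (0 < v) ∧
    ∀ n : ℕ,
      ((a11 + a22) - (d11 + d22) * (n : ℝ) ^ 2 / ℓ ^ 2 < 0) ∧
      (0 < d11 * d22 * (n : ℝ) ^ 4 / ℓ ^ 4
          - (d11 * a22 + d22 * a11 + d21 * a12 * v) * (n : ℝ) ^ 2 / ℓ ^ 2
          + a11 * a22 - a12 * b21) ∧
      ∀ lam : ℂ,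
        lam ^ 2 - (((a11 + a22) - (d11 + d22) * (n : ℝ) ^ 2 / ℓ ^ 2 : ℝ) : ℂ) * lam
          + ((d11 * d22 * (n : ℝ) ^ 4 / ℓ ^ 4
              - (d11 * a22 + d22 * a11 + d21 * a12 * v) * (n : ℝ) ^ 2 / ℓ ^ 2
              + a11 * a22 - a12 * b21 : ℝ) : ℂ) = 0 →
        lam.re < 0 := by
  intro a11 a12 a22 b21 v
  have hm : 0 < m + 1 := by linarith
  have hb : β < m + 1 := by nlinarith
  have hv : 0 < v := by
    have : β / (m + 1) < 1 := (div_lt_one hm).mpr hb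
    simp only [v]; linarith
  have ha11 : a11 < 0 := by
    have : 2 * β / (m + 1) ^ 2 < 1 := (div_lt_one (by positivity)).mpr (by linarith)
    simp only [a11]; linarith
  have ha12 : a12 < 0 := by
    apply div_neg_of_neg_of_pos _ (by positivity)
    exact mul_neg_of_pos_of_neg hβ0 (by linarith)
  have ha22 : a22 < 0 := neg_lt_zero.mpr hγ
  have hb21 : 0 < b21 := hγ
  clear_value a11 a12 a22 b21 v
  refine ⟨hb, hv, fun n => ?_⟩
  have hT : (a11 + a22) - (d11 + d22) * (n : ℝ) ^ 2 / ℓ ^ 2 < 0 := by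
    have : 0 ≤ (d11 + d22) * (n : ℝ) ^ 2 / ℓ ^ 2 := by positivity
    linarith
  have hJ : 0 < d11 * d22 * (n : ℝ) ^ 4 / ℓ ^ 4
          - (d11 * a22 + d22 * a11 + d21 * a12 * v) * (n : ℝ) ^ 2 / ℓ ^ 2
          + a11 * a22 - a12 * b21 := by
    have h1 : 0 ≤ d11 * d22 * (n : ℝ) ^ 4 / ℓ ^ 4 := by positivity
    have h2 : d11 * a22 + d22 * a11 + d21 * a12 * v ≤ 0 := by
      have e1 := mul_nonpos_of_nonneg_of_nonpos hd11 ha22.le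
      have e2 := mul_nonpos_of_nonneg_of_nonpos hd22 ha11.le
      have e3 := mul_nonpos_of_nonpos_of_nonneg
        (mul_nonpos_of_nonneg_of_nonpos hd21 ha12.le) hv.le
      linarith
    have h3 : (d11 * a22 + d22 * a11 + d21 * a12 * v) * (n : ℝ) ^ 2 / ℓ ^ 2 ≤ 0 :=
      div_nonpos_of_nonpos_of_nonneg
        (mul_nonpos_of_nonpos_of_nonneg h2 (by positivity)) (by positivity)
    have h4 := mul_pos_of_neg_of_neg ha11 ha22
    have h5 := mul_neg_of_neg_of_pos ha12 hb21
    linarith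
  exact ⟨hT, hJ, fun lam h => root_re_neg _ _ hT hJ lam h⟩
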